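/- arXiv:0911.0154 — 8 statements merged into one kernel-verified Lean document; each statement's English description precedes it below -/
import Mathlib

section
/- Let (X,d) be a locally compact, non-compact metric space that is a J-space (equivalently, a locally compact non-compact metric space with exactly one end). Then X has only finitely many pseudo-components, and exactly one of them is non-compact. -/
open Metric Set Filter Topology
open scoped ENNReal

/-- The radius of compactness of a point `x` in a metric space: the supremum of all
radii `r > 0` such that the closed closure of the open ball `B(x,r)` is compact. -/
noncomputable def radiusOfCompactness {X : Type*} [MetricSpace X] (x : X) : ℝ≥0∞ :=
  ⨆ (r : ℝ) (_ : 0 < r ∧ IsCompact (closure (Metric.ball x r))), ENNReal.ofReal r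

/-- The relation `x R y ↔ d(x,y) < ρ(x)`. -/
def pcRel {X : Type*} [MetricSpace X] (x y : X) : Prop :=
  ENNReal.ofReal (dist x y) < radiusOfCompactness x

/-- The equivalence relation `E`: `x E y` iff `x = y` or (`x R* y` and `y R* x`), where
`R*` is the transitive closure of `R`. -/
def pcEquiv {X : Type*} [MetricSpace X] (x y : X) : Prop :=
  x = y ∨ (Relation.TransGen pcRel x y ∧ Relation.TransGen pcRel y x)

/-- The pseudo-component of `x`: its `E`-equivalence class. -/
def pseudoComponent {X : Type*} [MetricSpace X] (x : X) : Set X :=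
  {y | pcEquiv x y}

/-- A topological space `X` is a J-space if whenever `A, B` are closed sets with
`A ∪ B = X` and `A ∩ B` compact, then `A` or `B` is compact. -/
def IsJSpace (X : Type*) [TopologicalSpace X] : Prop :=
  ∀ A B : Set X, IsClosed A → IsClosed B → A ∪ B = Set.univ →
    IsCompact (A ∩ B) → IsCompact A ∨ IsCompact B

theorem pcEquiv_equivalence {X : Type*} [MetricSpace X] :
    Equivalence (pcEquiv (X := X)) where
  refl _ := Or.inl rfl
  symm := by
    rintro x y (rfl | ⟨h, h'⟩)
    · exact Or.inl rfl
    · exact Or.inr ⟨h', h⟩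
  trans := by
    rintro x y z (rfl | ⟨h, h'⟩) (rfl | ⟨k, k'⟩)
    · exact Or.inl rfl
    · exact Or.inr ⟨k, k'⟩
    · exact Or.inr ⟨h, h'⟩
    · exact Or.inr ⟨h.trans k, k'.trans h'⟩

theorem mem_pseudoComponent_self {X : Type*} [MetricSpace X] (x : X) :
    x ∈ pseudoComponent x :=
  pcEquiv_equivalence.refl x

theorem pseudoComponent_eq_of_mem {X : Type*} [MetricSpace X] {x y : X}
    (h : y ∈ pseudoComponent x) : pseudoComponent y = pseudoComponent x :=
  Set.ext fun _ => ⟨pcEquiv_equivalence.trans h,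
    pcEquiv_equivalence.trans (pcEquiv_equivalence.symm h)⟩

theorem pairwiseDisjoint_pseudoComponents {X : Type*} [MetricSpace X] :
    (Set.range (pseudoComponent (X := X))).PairwiseDisjoint id := by
  rintro _ ⟨x, rfl⟩ _ ⟨y, rfl⟩ hne
  refine Set.disjoint_left.2 fun z hx hy => hne ?_
  rw [← pseudoComponent_eq_of_mem hx, pseudoComponent_eq_of_mem hy]

theorem pcRel_of_isCompact_closure_ball {X : Type*} [MetricSpace X] {x y : X} {r : ℝ}
    (hc : IsCompact (closure (Metric.ball x r))) (h : dist x y < r) : pcRel x y := by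
  have hr : 0 < r := dist_nonneg.trans_lt h
  exact ((ENNReal.ofReal_lt_ofReal_iff hr).2 h).trans_le
    (le_iSup₂ (f := fun (r : ℝ) (_ : 0 < r ∧ IsCompact (closure (Metric.ball x r))) =>
      ENNReal.ofReal r) r ⟨hr, hc⟩)

theorem exists_isCompact_closure_ball {X : Type*} [MetricSpace X] [LocallyCompactSpace X]
    (x : X) : ∃ r > 0, IsCompact (closure (Metric.ball x r)) := by
  obtain ⟨K, hK, hx⟩ := exists_compact_mem_nhds x
  obtain ⟨r, hr, hrK⟩ := Metric.mem_nhds_iff.1 hx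
  exact ⟨r, hr, hK.closure_of_subset hrK⟩

theorem pseudoComponent_mem_nhds {X : Type*} [MetricSpace X] [LocallyCompactSpace X]
    (x : X) : pseudoComponent x ∈ 𝓝 x := by
  obtain ⟨r, hr, hc⟩ := exists_isCompact_closure_ball x
  refine Metric.mem_nhds_iff.2 ⟨r / 2, half_pos hr, fun y hy => ?_⟩
  rw [Metric.mem_ball] at hy
  have hball : Metric.ball y (r / 2) ⊆ Metric.ball x r :=
    Metric.ball_subset_ball' (by linarith)
  have hc' : IsCompact (closure (Metric.ball y (r / 2))) :=
    hc.of_isClosed_subset isClosed_closure (closure_mono hball)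
  exact Or.inr ⟨.single (pcRel_of_isCompact_closure_ball hc (by rw [dist_comm]; linarith)),
    .single (pcRel_of_isCompact_closure_ball hc' hy)⟩

theorem isOpen_pseudoComponent {X : Type*} [MetricSpace X] [LocallyCompactSpace X]
    (x : X) : IsOpen (pseudoComponent x) :=
  isOpen_iff_mem_nhds.2 fun y hy => by
    simpa only [pseudoComponent_eq_of_mem hy] using pseudoComponent_mem_nhds y

theorem sUnion_range_pseudoComponent {X : Type*} [MetricSpace X] :
    ⋃₀ Set.range (pseudoComponent (X := X)) = Set.univ :=
  Set.eq_univ_of_forall fun x => ⟨_, ⟨x, rfl⟩, mem_pseudoComponent_self x⟩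

/-- A disjoint family of nonempty open sets with compact union is finite. -/
theorem IsCompact.finite_of_sUnion_pairwiseDisjoint {X : Type*} [TopologicalSpace X]
    {T : Set (Set X)} (hT : IsCompact (⋃₀ T)) (ho : ∀ s ∈ T, IsOpen s)
    (hne : ∀ s ∈ T, s.Nonempty) (hd : T.PairwiseDisjoint id) : T.Finite := by
  obtain ⟨F, hFT, hF, hcover⟩ := hT.elim_finite_subcover_image (b := T) (c := id) ho
    (by simp [Set.sUnion_eq_biUnion])
  refine hF.subset fun s hs => ?_
  obtain ⟨x, hx⟩ := hne s hs
  obtain ⟨t, ht, hxt⟩ := Set.mem_iUnion₂.1 (hcover ⟨s, hs, hx⟩)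
  rwa [hd.elim_set hs (hFT ht) x hx hxt]

/-- In a J-space, of two complementary open sets one is compact. -/
theorem IsJSpace.isCompact_or_isCompact_of_isCompl {X : Type*} [TopologicalSpace X]
    (hJ : IsJSpace X) {A B : Set X} (hA : IsOpen A) (hB : IsOpen B) (h : IsCompl A B) :
    IsCompact A ∨ IsCompact B :=
  hJ A B (by rw [← h.symm.compl_eq]; exact hB.isClosed_compl)
    (by rw [← h.compl_eq]; exact hA.isClosed_compl) h.sup_eq_top
    (by rw [h.disjoint.inter_eq]; exact isCompact_empty)

/-- A partition of a J-space into nonempty open sets is finite. -/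
theorem IsJSpace.finite_of_isOpen_partition {X : Type*} [TopologicalSpace X]
    (hJ : IsJSpace X) {S : Set (Set X)} (ho : ∀ s ∈ S, IsOpen s)
    (hne : ∀ s ∈ S, s.Nonempty) (hd : S.PairwiseDisjoint id) (hU : ⋃₀ S = Set.univ) :
    S.Finite := by
  by_contra hS
  obtain ⟨T, U, hTU, hdisj, hcard⟩ :=
    Set.Infinite.exists_union_disjoint_cardinal_eq_of_infinite hS
  have hTS : T ⊆ S := hTU ▸ Set.subset_union_left
  have hUS : U ⊆ S := hTU ▸ Set.subset_union_right
  have hfin : T.Finite ↔ U.Finite := by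
    rw [← Cardinal.lt_aleph0_iff_set_finite, ← Cardinal.lt_aleph0_iff_set_finite, hcard]
  have hfinite : T.Finite ∨ U.Finite := by
    refine (hJ.isCompact_or_isCompact_of_isCompl
      (isOpen_sUnion fun s hs => ho s (hTS hs)) (isOpen_sUnion fun s hs => ho s (hUS hs))
      (IsCompl.of_eq ?_ ?_)).imp
      (fun h => h.finite_of_sUnion_pairwiseDisjoint (fun s hs => ho s (hTS hs))
        (fun s hs => hne s (hTS hs)) (hd.subset hTS))
      (fun h => h.finite_of_sUnion_pairwiseDisjoint (fun s hs => ho s (hUS hs))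
        (fun s hs => hne s (hUS hs)) (hd.subset hUS))
    · refine Set.disjoint_iff_inter_eq_empty.1 (Set.disjoint_sUnion_left.2 fun s hs =>
        Set.disjoint_sUnion_right.2 fun t ht => hd (hTS hs) (hUS ht) ?_)
      rintro rfl
      exact Set.disjoint_left.1 hdisj hs ht
    · exact (Set.sUnion_union T U).symm.trans (hTU ▸ hU)
  apply hS
  rw [← hTU]
  rcases hfinite with h | h
  · exact h.union (hfin.1 h)
  · exact (hfin.2 h).union h

/-- A locally compact, non-compact metric J-space has only finitely many
pseudo-components, exactly one of which is non-compact. -/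
theorem finitely_many_pseudoComponents_unique_noncompact
    {X : Type*} [MetricSpace X] [LocallyCompactSpace X]
    (hnc : ¬ CompactSpace X) (hJ : IsJSpace X) :
    (Set.range (pseudoComponent (X := X))).Finite ∧
      ∃! C, C ∈ Set.range (pseudoComponent (X := X)) ∧ ¬ IsCompact C := by
  have hfin : (Set.range (pseudoComponent (X := X))).Finite := by
    refine hJ.finite_of_isOpen_partition ?_ ?_ pairwiseDisjoint_pseudoComponents
      sUnion_range_pseudoComponent
    · rintro _ ⟨x, rfl⟩
      exact isOpen_pseudoComponent x
    · rintro _ ⟨x, rfl⟩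
      exact ⟨x, mem_pseudoComponent_self x⟩
  have hex : ∃ C ∈ Set.range (pseudoComponent (X := X)), ¬ IsCompact C := by
    by_contra! h
    refine hnc ⟨?_⟩
    rw [← sUnion_range_pseudoComponent]
    exact hfin.isCompact_sUnion h
  obtain ⟨C, hC, hCnc⟩ := hex
  refine ⟨hfin, C, ⟨hC, hCnc⟩, ?_⟩
  rintro D ⟨hD, hDnc⟩
  by_contra hne
  have hdisj : Disjoint D C := pairwiseDisjoint_pseudoComponents hD hC hne
  have hclosed : ∀ E ∈ Set.range (pseudoComponent (X := X)), IsClosed E := by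
    rintro _ ⟨x, rfl⟩
    refine isClosed_of_closure_subset fun y hy => ?_
    obtain ⟨z, hzy, hzx⟩ := mem_closure_iff.1 hy _ (isOpen_pseudoComponent y)
      (mem_pseudoComponent_self y)
    exact pcEquiv_equivalence.trans hzx (pcEquiv_equivalence.symm hzy)
  have hCo : IsOpen C := by
    obtain ⟨x, rfl⟩ := hC
    exact isOpen_pseudoComponent x
  rcases hJ.isCompact_or_isCompact_of_isCompl hCo (hclosed C hC).isOpen_compl isCompl_compl
    with h | h
  · exact hCnc h
  · exact hDnc (h.of_isClosed_subset (hclosed D hD) hdisj.subset_compl_right)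
end

section
/- Let (X,d) be a locally compact, non-compact metric space that is a J-space, and let P be its unique non-compact pseudo-component. Then X \ P is a compact subset of X. -/
open Metric Set Filter Topology
open scoped ENNReal

theorem pcEquiv.symm {X : Type*} [MetricSpace X] {x y : X} (h : pcEquiv x y) : pcEquiv y x :=
  h.elim (fun h => Or.inl h.symm) (fun h => Or.inr h.symm)

theorem pcEquiv.trans {X : Type*} [MetricSpace X] {x y z : X} (h : pcEquiv x y)
    (h' : pcEquiv y z) : pcEquiv x z := by
  rcases h with rfl | h
  · exact h'
  rcases h' with rfl | h'
  · exact Or.inr h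
  exact Or.inr ⟨h.1.trans h'.1, h'.2.trans h.2⟩

theorem ofReal_le_radiusOfCompactness {X : Type*} [MetricSpace X] {x : X} {r : ℝ} (hr : 0 < r)
    (hc : IsCompact (closure (ball x r))) : ENNReal.ofReal r ≤ radiusOfCompactness x :=
  le_iSup₂_of_le (f := fun (s : ℝ) (_ : 0 < s ∧ IsCompact (closure (ball x s))) =>
    ENNReal.ofReal s) r ⟨hr, hc⟩ le_rfl

theorem pcRel_of_dist_lt {X : Type*} [MetricSpace X] {x y : X} {r : ℝ}
    (hc : IsCompact (closure (ball x r))) (h : dist x y < r) : pcRel x y := by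
  have hr : 0 < r := dist_nonneg.trans_lt h
  exact ((ENNReal.ofReal_lt_ofReal_iff hr).2 h).trans_le (ofReal_le_radiusOfCompactness hr hc)

theorem eventually_pcEquiv {X : Type*} [MetricSpace X] [LocallyCompactSpace X] (x : X) :
    ∀ᶠ y in 𝓝 x, pcEquiv x y := by
  obtain ⟨K, hK, hxK⟩ := exists_compact_mem_nhds x
  obtain ⟨r, hr, hrK⟩ := Metric.mem_nhds_iff.1 hxK
  have hcompact {y : X} {s : ℝ} (hs : ball y s ⊆ ball x r) : IsCompact (closure (ball y s)) :=
    hK.closure_of_subset (hs.trans hrK)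
  filter_upwards [ball_mem_nhds x (half_pos hr)] with y hy
  have hyx : dist y x < r / 2 := hy
  refine Or.inr ⟨.single (pcRel_of_dist_lt (r := r) (hcompact subset_rfl) ?_),
    .single (pcRel_of_dist_lt (r := r / 2) (hcompact (ball_subset_ball' ?_)) hyx)⟩
  · rw [dist_comm]
    linarith
  · linarith

theorem isClopen_pseudoComponent {X : Type*} [MetricSpace X] [LocallyCompactSpace X] (x : X) :
    IsClopen (pseudoComponent x) := by
  refine ⟨isOpen_compl_iff.1 (isOpen_iff_mem_nhds.2 fun y hy => ?_),
    isOpen_iff_mem_nhds.2 fun y hy => ?_⟩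
  · filter_upwards [eventually_pcEquiv y] with z hz
    exact fun hxz => hy (pcEquiv.trans hxz hz.symm)
  · filter_upwards [eventually_pcEquiv y] with z hz
    exact pcEquiv.trans hy hz

/-- In a locally compact, non-compact metric J-space, the complement of the
unique non-compact pseudo-component `P` is compact. -/
theorem compl_of_noncompact_pseudoComponent_isCompact
    {X : Type*} [MetricSpace X] [LocallyCompactSpace X]
    (hnc : ¬ CompactSpace X) (hJ : IsJSpace X)
    (P : Set X) (hP : P ∈ Set.range (pseudoComponent (X := X)))
    (hPnc : ¬ IsCompact P) :
    IsCompact Pᶜ := by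
  obtain ⟨x, rfl⟩ := hP
  have hclopen := isClopen_pseudoComponent x
  exact (hJ _ _ hclopen.isClosed hclopen.compl.isClosed (union_compl_self _)
    (by simp)).resolve_left hPnc
end

section
/- Let X be a non-compact J-space and let 𝒜 = {A_i : i ∈ I} be a partition of X into non-empty closed-open sets. Then 𝒜 is finite, exactly one of its members is non-compact, and the complement of the non-compact member is a compact subset of X. -/
open Set

/-- In a J-space, a clopen set or its complement is compact. -/
theorem IsJSpace.isCompact_or_isCompact_compl {X : Type*} [TopologicalSpace X]
    (hJ : IsJSpace X) {C : Set X} (hC : IsClopen C) : IsCompact C ∨ IsCompact Cᶜ :=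
  hJ C Cᶜ hC.isClosed hC.compl.isClosed (union_compl_self C) (by simp)

/-- A pairwise disjoint family of non-empty open sets with compact union is finite. -/
theorem Set.PairwiseDisjoint.finite_of_isCompact_sUnion {X : Type*} [TopologicalSpace X]
    {ℬ : Set (Set X)} (hdisj : ℬ.PairwiseDisjoint id) (hne : ∀ A ∈ ℬ, A.Nonempty)
    (hopen : ∀ A ∈ ℬ, IsOpen A) (hc : IsCompact (⋃₀ ℬ)) : ℬ.Finite := by
  obtain ⟨t, ht⟩ := hc.elim_finite_subcover (fun A : ℬ => (A : Set X))
    (fun A => hopen A A.2) (by rw [sUnion_eq_iUnion])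
  refine (t.finite_toSet.image Subtype.val).subset fun A hA => ?_
  obtain ⟨x, hx⟩ := hne A hA
  obtain ⟨B, hBt, hxB⟩ := mem_iUnion₂.1 (ht (mem_sUnion_of_mem hx hA))
  exact ⟨B, hBt, hdisj.elim_set B.2 hA x hxB hx⟩

/-- The union of a subfamily of a partition has the union of the remaining members as its
complement. -/
theorem Set.PairwiseDisjoint.compl_sUnion_eq_sUnion_sdiff {X : Type*} {𝒜 ℬ : Set (Set X)}
    (hdisj : 𝒜.PairwiseDisjoint id) (hcover : ⋃₀ 𝒜 = univ) (hℬ : ℬ ⊆ 𝒜) :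
    (⋃₀ ℬ)ᶜ = ⋃₀ (𝒜 \ ℬ) := by
  ext x
  constructor
  · intro hx
    obtain ⟨A, hA, hxA⟩ := mem_sUnion.1 (hcover ▸ mem_univ x)
    exact ⟨A, ⟨hA, fun h => hx ⟨A, h, hxA⟩⟩, hxA⟩
  · rintro ⟨A, ⟨hA, hAB⟩, hxA⟩ ⟨B, hB, hxB⟩
    exact hAB (hdisj.elim_set hA (hℬ hB) x hxA hxB ▸ hB)

/-- A partition of a J-space into non-empty clopen sets is finite. -/
theorem IsJSpace.finite_of_clopen_partition {X : Type*} [TopologicalSpace X]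
    (hJ : IsJSpace X) {𝒜 : Set (Set X)} (hne : ∀ A ∈ 𝒜, A.Nonempty)
    (hclopen : ∀ A ∈ 𝒜, IsClopen A) (hdisj : 𝒜.PairwiseDisjoint id)
    (hcover : ⋃₀ 𝒜 = univ) : 𝒜.Finite := by
  by_contra hinf
  obtain ⟨ℬ, 𝒞, hunion, hBC, hcard⟩ :=
    Set.Infinite.exists_union_disjoint_cardinal_eq_of_infinite hinf
  obtain ⟨e⟩ := Cardinal.eq.1 hcard
  have hB : ℬ ⊆ 𝒜 := hunion ▸ subset_union_left
  have hC : 𝒞 ⊆ 𝒜 := hunion ▸ subset_union_right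
  have hdiff : 𝒜 \ ℬ = 𝒞 := by rw [← hunion, union_sdiff_cancel_left hBC.le_bot]
  have hcompl : (⋃₀ ℬ)ᶜ = ⋃₀ 𝒞 := by
    rw [hdisj.compl_sUnion_eq_sUnion_sdiff hcover hB, hdiff]
  have hopen : ∀ 𝒟 ⊆ 𝒜, IsOpen (⋃₀ 𝒟) := fun 𝒟 h𝒟 =>
    isOpen_sUnion fun A hA => (hclopen A (h𝒟 hA)).isOpen
  have hfin : ∀ 𝒟 ⊆ 𝒜, IsCompact (⋃₀ 𝒟) → 𝒟.Finite := fun 𝒟 h𝒟 =>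
    (hdisj.subset h𝒟).finite_of_isCompact_sUnion (fun A hA => hne A (h𝒟 hA))
      fun A hA => (hclopen A (h𝒟 hA)).isOpen
  have hiff : ℬ.Finite ↔ 𝒞.Finite := e.finite_iff
  have hor : ℬ.Finite ∨ 𝒞.Finite :=
    (hJ.isCompact_or_isCompact_compl
      ⟨isOpen_compl_iff.1 (hcompl ▸ hopen 𝒞 hC), hopen ℬ hB⟩).imp
      (hfin ℬ hB) fun h => hfin 𝒞 hC (hcompl ▸ h)
  refine hinf (hunion ▸ ?_)
  rcases hor with h | h
  · exact h.union (hiff.1 h)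
  · exact (hiff.2 h).union h

/-- A partition of a non-compact J-space into non-empty clopen sets is
finite, has exactly one non-compact member, and the complement of that member is
compact. -/
theorem clopen_partition_of_JSpace_finite
    {X : Type*} [TopologicalSpace X] (hnc : ¬ CompactSpace X) (hJ : IsJSpace X)
    (𝒜 : Set (Set X))
    (hne : ∀ A ∈ 𝒜, A.Nonempty)
    (hclopen : ∀ A ∈ 𝒜, IsClopen A)
    (hdisj : 𝒜.PairwiseDisjoint id)
    (hcover : ⋃₀ 𝒜 = Set.univ) :
    𝒜.Finite ∧ (∃! A, A ∈ 𝒜 ∧ ¬ IsCompact A) ∧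
      ∀ A ∈ 𝒜, ¬ IsCompact A → IsCompact Aᶜ := by
  have hfin : 𝒜.Finite := hJ.finite_of_clopen_partition hne hclopen hdisj hcover
  have hcompl : ∀ A ∈ 𝒜, ¬ IsCompact A → IsCompact Aᶜ := fun A hA hAc =>
    (hJ.isCompact_or_isCompact_compl (hclopen A hA)).resolve_left hAc
  refine ⟨hfin, ?_, hcompl⟩
  obtain ⟨A, hA, hAc⟩ : ∃ A ∈ 𝒜, ¬ IsCompact A := by
    by_contra! h
    exact hnc ⟨hcover ▸ hfin.isCompact_sUnion h⟩
  refine ⟨A, ⟨hA, hAc⟩, fun B ⟨hB, hBc⟩ => ?_⟩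
  by_contra hBA
  exact hBc ((hcompl A hA hAc).of_isClosed_subset (hclopen B hB).isClosed
    (hdisj hB hA hBA).subset_compl_right)
end

section
/- Every metrizable, locally compact J-space has a countable base (is second countable). -/
open Set

/-- A paracompact, locally compact Hausdorff space has a locally finite cover by relatively
compact open sets. -/
theorem exists_locallyFinite_open_cover_isCompact_closure (X : Type*) [TopologicalSpace X]
    [T2Space X] [ParacompactSpace X] [LocallyCompactSpace X] :
    ∃ v : X → Set X, (∀ i, IsOpen (v i)) ∧ (∀ i, IsCompact (closure (v i))) ∧
      LocallyFinite v ∧ ⋃ i, v i = univ := by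
  choose c hc hcx using fun x : X => exists_compact_mem_nhds x
  obtain ⟨v, hvo, hvU, hvf, hvs⟩ := precise_refinement (fun x => interior (c x))
    (fun _ => isOpen_interior)
    (iUnion_eq_univ_iff.2 fun x => ⟨x, mem_interior_iff_mem_nhds.2 (hcx x)⟩)
  exact ⟨v, hvo, fun i => (hc i).closure_of_subset ((hvs i).trans interior_subset), hvf, hvU⟩

/-- A set containing every member of an open cover that it meets is clopen. -/
theorem isClopen_of_forall_inter_nonempty_subset {X ι : Type*} [TopologicalSpace X]
    {v : ι → Set X} (hvo : ∀ i, IsOpen (v i)) (hvU : ⋃ i, v i = univ) {W : Set X}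
    (hW : ∀ i, (v i ∩ W).Nonempty → v i ⊆ W) : IsClopen W := by
  constructor
  · refine isClosed_of_closure_subset fun x hx => ?_
    obtain ⟨i, hi⟩ := iUnion_eq_univ_iff.1 hvU x
    exact hW i (mem_closure_iff.1 hx _ (hvo i) hi) hi
  · refine isOpen_iff_mem_nhds.2 fun x hx => ?_
    obtain ⟨i, hi⟩ := iUnion_eq_univ_iff.1 hvU x
    exact Filter.mem_of_superset ((hvo i).mem_nhds hi) (hW i ⟨x, hi, hx⟩)

/-- A noncompact, paracompact, locally compact Hausdorff space has a noncompact clopen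
σ-compact subset. -/
theorem exists_isClopen_isSigmaCompact_not_isCompact (X : Type*) [TopologicalSpace X]
    [T2Space X] [ParacompactSpace X] [LocallyCompactSpace X] [NoncompactSpace X] :
    ∃ W : Set X, IsClopen W ∧ IsSigmaCompact W ∧ ¬ IsCompact W := by
  obtain ⟨v, hvo, hvc, hvf, hvU⟩ := exists_locallyFinite_open_cover_isCompact_closure X
  have enlarge (K : TopologicalSpace.Compacts X) : ∃ L : TopologicalSpace.Compacts X,
      (∀ i, (v i ∩ K).Nonempty → v i ⊆ L) ∧ ¬ (L : Set X) ⊆ K := by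
    obtain ⟨x, hx⟩ := (ne_univ_iff_exists_notMem _).1 K.isCompact.ne_univ
    refine ⟨⟨(⋃ i ∈ {i | (v i ∩ K).Nonempty}, closure (v i)) ∪ {x},
      ((hvf.finite_nonempty_inter_compact K.isCompact).isCompact_biUnion
        fun i _ => hvc i).union isCompact_singleton⟩, fun i hi => ?_, fun h => hx (h (.inr rfl))⟩
    exact subset_closure.trans ((subset_biUnion_of_mem
      (u := fun i => closure (v i)) hi).trans subset_union_left)
  choose f hf hfK using enlarge
  let K (n : ℕ) : TopologicalSpace.Compacts X := f^[n] ⊥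
  have hK (n : ℕ) : K (n + 1) = f (K n) := Function.iterate_succ_apply' f n ⊥
  have hint (n : ℕ) : (K n : Set X) ⊆ interior (K (n + 1)) := fun x hx => by
    obtain ⟨i, hi⟩ := iUnion_eq_univ_iff.1 hvU x
    rw [hK]
    exact interior_maximal (hf _ i ⟨x, hi, hx⟩) (hvo i) hi
  have hmono : Monotone fun n => (K n : Set X) :=
    monotone_nat_of_le_succ fun n => (hint n).trans interior_subset
  refine ⟨⋃ n, K n, isClopen_of_forall_inter_nonempty_subset hvo hvU ?_,
    isSigmaCompact_iUnion_of_isCompact _ fun n => (K n).isCompact, fun hc => ?_⟩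
  · rintro i ⟨x, hxi, hx⟩
    obtain ⟨n, hn⟩ := mem_iUnion.1 hx
    refine Subset.trans ?_ (subset_iUnion _ (n + 1))
    rw [hK]
    exact hf _ i ⟨x, hxi, hn⟩
  · obtain ⟨n, hn⟩ := hc.elim_directed_cover (fun n => interior (K n : Set X))
      (fun _ => isOpen_interior)
      (iUnion_subset fun n => (hint n).trans
        (subset_iUnion (fun n => interior (K n : Set X)) (n + 1)))
      (Monotone.directed_le fun m n h => interior_mono (hmono h))
    apply hfK (K n)
    rw [← hK]
    exact (subset_iUnion (fun n => (K n : Set X)) (n + 1)).trans (hn.trans interior_subset)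

/-- A paracompact, locally compact Hausdorff J-space is σ-compact. -/
theorem IsJSpace.sigmaCompactSpace {X : Type*} [TopologicalSpace X] [T2Space X]
    [ParacompactSpace X] [LocallyCompactSpace X] (hJ : IsJSpace X) : SigmaCompactSpace X := by
  by_cases hX : CompactSpace X
  · infer_instance
  have := not_compactSpace_iff.1 hX
  obtain ⟨W, hW, hWs, hWc⟩ := exists_isClopen_isSigmaCompact_not_isCompact X
  have hWc' : IsCompact Wᶜ := (hJ W Wᶜ hW.isClosed hW.compl.isClosed (union_compl_self W)
    (by simp)).resolve_left hWc
  rw [← isSigmaCompact_univ_iff, ← union_compl_self W, union_eq_iUnion]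
  exact isSigmaCompact_iUnion _ (Bool.forall_bool.2 ⟨hWc'.isSigmaCompact, hWs⟩)

/-- Every metrizable, locally compact J-space is second countable. -/
theorem metrizable_locallyCompact_JSpace_secondCountable
    {X : Type*} [TopologicalSpace X] [TopologicalSpace.MetrizableSpace X]
    [LocallyCompactSpace X] (hJ : IsJSpace X) :
    SecondCountableTopology X := by
  let _ := TopologicalSpace.metrizableSpaceMetric X
  have := hJ.sigmaCompactSpace
  exact EMetric.secondCountable_of_sigmaCompact X
end

section
/- Let (X,d) be a locally compact metric space, G its group of surjective isometries, and x, y ∈ X. If y lies in the closure of the orbit {g·x : g ∈ G}, then there exists a distance-preserving map f : C_x → X with f(x) = y and f(C_x) = C_y, where C_x and C_y denote the pseudo-components of x and y. -/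
open Metric Set Filter Topology
open scoped ENNReal

section OrbitLimits

variable {X ι : Type*} [MetricSpace X]

theorem isCompact_closedBall_of_lt_radiusOfCompactness {x : X} {s : ℝ}
    (hs : ENNReal.ofReal s < radiusOfCompactness x) : IsCompact (closedBall x s) := by
  simp only [radiusOfCompactness, lt_iSup_iff] at hs
  obtain ⟨r, ⟨hr, hc⟩, hsr⟩ := hs
  have hlt : s < r := (ENNReal.ofReal_lt_ofReal_iff hr).1 hsr
  exact hc.of_isClosed_subset isClosed_closedBall
    ((closedBall_subset_ball hlt).trans subset_closure)

theorem tendsto_isometryEquiv_symm {l : Filter ι} {g : ι → X ≃ᵢ X} {u v : X}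
    (h : Tendsto (fun i => g i u) l (𝓝 v)) : Tendsto (fun i => (g i).symm v) l (𝓝 u) := by
  rw [tendsto_iff_dist_tendsto_zero] at h ⊢
  refine h.congr fun i => ?_
  rw [← (g i).dist_eq ((g i).symm v) u, IsometryEquiv.apply_symm_apply, dist_comm]

theorem radiusOfCompactness_le_of_tendsto {l : Filter ι} [l.NeBot] {g : ι → X ≃ᵢ X} {u v : X}
    (h : Tendsto (fun i => g i u) l (𝓝 v)) :
    radiusOfCompactness u ≤ radiusOfCompactness v := by
  refine iSup₂_le fun r hr => ?_
  obtain ⟨hr, hc⟩ := hr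
  refine le_of_forall_lt fun a ha => ?_
  obtain ⟨b, hab, hbr⟩ := exists_between ha
  have hb : b ≠ ∞ := hbr.ne_top
  have hb0 : 0 < b.toReal := ENNReal.toReal_pos (ne_bot_of_gt hab) hb
  have hlt : b.toReal < r := (ENNReal.lt_ofReal_iff_toReal_lt hb).1 hbr
  obtain ⟨i, hi⟩ := ((Metric.tendsto_nhds.1 h) (r - b.toReal) (sub_pos.2 hlt)).exists
  have hsub : ball v b.toReal ⊆ g i '' closure (ball u r) := by
    refine Subset.trans ?_ (image_mono subset_closure)
    rw [IsometryEquiv.image_ball]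
    refine ball_subset_ball' ?_
    rw [dist_comm]
    linarith
  have hcomp : IsCompact (closure (ball v b.toReal)) :=
    (hc.image (g i).continuous).closure_of_subset hsub
  refine hab.trans_le ?_
  rw [← ENNReal.ofReal_toReal hb]
  exact le_iSup₂ (f := fun (r : ℝ) (_ : 0 < r ∧ IsCompact (closure (ball v r))) =>
    ENNReal.ofReal r) b.toReal ⟨hb0, hcomp⟩

theorem radiusOfCompactness_eq_of_tendsto {l : Filter ι} [l.NeBot] {g : ι → X ≃ᵢ X} {u v : X}
    (h : Tendsto (fun i => g i u) l (𝓝 v)) :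
    radiusOfCompactness u = radiusOfCompactness v :=
  (radiusOfCompactness_le_of_tendsto h).antisymm
    (radiusOfCompactness_le_of_tendsto (tendsto_isometryEquiv_symm h))

theorem dist_eq_of_tendsto_isometryEquiv {l : Filter ι} [l.NeBot] {g : ι → X ≃ᵢ X}
    {u u' v v' : X} (hu : Tendsto (fun i => g i u) l (𝓝 u'))
    (hv : Tendsto (fun i => g i v) l (𝓝 v')) : dist u' v' = dist u v := by
  refine tendsto_nhds_unique (hu.dist hv) ?_
  simp only [IsometryEquiv.dist_eq]
  exact tendsto_const_nhds

theorem exists_tendsto_of_pcRel {U : Ultrafilter ι} {g : ι → X ≃ᵢ X} {u u' v : X}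
    (hu : Tendsto (fun i => g i u) U (𝓝 u')) (huv : pcRel u v) :
    ∃ v', Tendsto (fun i => g i v) U (𝓝 v') ∧ pcRel u' v' := by
  have hrad := radiusOfCompactness_eq_of_tendsto hu
  obtain ⟨b, hb, hbr⟩ := exists_between huv
  have hbt : b ≠ ∞ := hbr.ne_top
  have hlt : dist u v < b.toReal := (ENNReal.ofReal_lt_iff_lt_toReal dist_nonneg hbt).1 hb
  have hc : IsCompact (closedBall u' b.toReal) := by
    apply isCompact_closedBall_of_lt_radiusOfCompactness
    rwa [ENNReal.ofReal_toReal hbt, ← hrad]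
  have hev : ∀ᶠ i in (U : Filter ι), g i v ∈ closedBall u' b.toReal := by
    filter_upwards [Metric.tendsto_nhds.1 hu (b.toReal - dist u v) (sub_pos.2 hlt)] with i hi
    have h1 := dist_triangle (g i v) (g i u) u'
    rw [IsometryEquiv.dist_eq, dist_comm v u] at h1
    rw [mem_closedBall]
    linarith
  obtain ⟨v', -, hv'⟩ := hc.ultrafilter_le_nhds (U.map fun i => g i v)
    (le_principal_iff.2 hev)
  have hv : Tendsto (fun i => g i v) U (𝓝 v') := hv'
  refine ⟨v', hv, ?_⟩
  rwa [pcRel, dist_eq_of_tendsto_isometryEquiv hu hv, ← hrad]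

theorem exists_tendsto_of_transGen_pcRel {U : Ultrafilter ι} {g : ι → X ≃ᵢ X} {u u' v : X}
    (hu : Tendsto (fun i => g i u) U (𝓝 u')) (huv : Relation.TransGen pcRel u v) :
    ∃ v', Tendsto (fun i => g i v) U (𝓝 v') ∧ Relation.TransGen pcRel u' v' := by
  induction huv with
  | single h =>
    obtain ⟨v', hv, hr⟩ := exists_tendsto_of_pcRel hu h
    exact ⟨v', hv, .single hr⟩
  | tail _ h ih =>
    obtain ⟨w', hw, hr⟩ := ih
    obtain ⟨v', hv, hr'⟩ := exists_tendsto_of_pcRel hw h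
    exact ⟨v', hv, hr.tail hr'⟩

theorem exists_tendsto_of_pcEquiv {U : Ultrafilter ι} {g : ι → X ≃ᵢ X} {u u' v : X}
    (hu : Tendsto (fun i => g i u) U (𝓝 u')) (huv : pcEquiv u v) :
    ∃ v', Tendsto (fun i => g i v) U (𝓝 v') ∧ pcEquiv u' v' := by
  obtain rfl | ⟨h, h'⟩ := huv
  · exact ⟨u', hu, .inl rfl⟩
  · obtain ⟨v', hv, hr⟩ := exists_tendsto_of_transGen_pcRel hu h
    obtain ⟨w, hw, hr'⟩ := exists_tendsto_of_transGen_pcRel hv h'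
    obtain rfl := tendsto_nhds_unique hu hw
    exact ⟨v', hv, .inr ⟨hr, hr'⟩⟩

end OrbitLimits

/-- If `y` lies in the closure of the orbit of `x` under the isometry group,
then there is a distance-preserving map `f : C_x → X` with `f(x) = y` and
`f(C_x) = C_y`. -/
theorem exists_isometric_limit_map_on_pseudoComponent
    {X : Type*} [MetricSpace X] [LocallyCompactSpace X] (x y : X)
    (hy : y ∈ closure {z : X | ∃ g : X ≃ᵢ X, g x = z}) :
    ∃ f : pseudoComponent x → X,
      (∀ u v : pseudoComponent x, dist (f u) (f v) = dist (u : X) (v : X)) ∧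
      f ⟨x, Or.inl rfl⟩ = y ∧
      Set.range f = pseudoComponent y := by
  have hne : (comap (fun g : X ≃ᵢ X => g x) (𝓝 y)).NeBot := by
    rw [comap_neBot_iff]
    intro t ht
    obtain ⟨z, hzt, g, rfl⟩ := mem_closure_iff_nhds.1 hy t ht
    exact ⟨g, hzt⟩
  let U : Ultrafilter (X ≃ᵢ X) := Ultrafilter.of (comap (fun g : X ≃ᵢ X => g x) (𝓝 y))
  have hx : Tendsto (fun g : X ≃ᵢ X => g x) U (𝓝 y) :=
    tendsto_comap.mono_left (Ultrafilter.of_le _)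
  have hlim := fun u : pseudoComponent x => exists_tendsto_of_pcEquiv (g := id) hx u.2
  choose f hf hfy using hlim
  refine ⟨f, fun u v => dist_eq_of_tendsto_isometryEquiv (hf u) (hf v),
    tendsto_nhds_unique (hf _) hx, Subset.antisymm (range_subset_iff.2 hfy) fun v hv => ?_⟩
  obtain ⟨w, hw, hxw⟩ := exists_tendsto_of_pcEquiv (U := U) (g := IsometryEquiv.symm)
    (tendsto_isometryEquiv_symm (g := id) hx) hv
  exact ⟨⟨w, hxw⟩, tendsto_nhds_unique (hf ⟨w, hxw⟩) (tendsto_isometryEquiv_symm hw)⟩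
end

section
/- Let (X,d) be a locally compact metric space with a countable base, G its group of surjective isometries, x, y ∈ X, and {g_n} a sequence in G with g_n·x → y. Then there exist a subsequence {g_{n_k}} and a distance-preserving map f : C_x → X such that g_{n_k}·z → f(z) for every z ∈ C_x, f(x) = y, and f(C_x) = C_{f(x)}. -/
open Metric Set Filter Topology
open scoped ENNReal

theorem pcRel_iff {X : Type*} [MetricSpace X] {u v : X} :
    pcRel u v ↔ ∃ r : ℝ, dist u v < r ∧ IsCompact (closure (Metric.ball u r)) := by
  simp only [pcRel, radiusOfCompactness, lt_iSup_iff]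
  constructor
  · rintro ⟨r, ⟨hr, hc⟩, h⟩
    exact ⟨r, (ENNReal.ofReal_lt_ofReal_iff hr).1 h, hc⟩
  · rintro ⟨r, h, hc⟩
    have hr : 0 < r := dist_nonneg.trans_lt h
    exact ⟨r, ⟨hr, hc⟩, (ENNReal.ofReal_lt_ofReal_iff hr).2 h⟩

theorem IsometryEquiv.isCompact_closure_ball {X : Type*} [MetricSpace X] (g : X ≃ᵢ X)
    {u : X} {r : ℝ} (h : IsCompact (closure (Metric.ball u r))) :
    IsCompact (closure (Metric.ball (g u) r)) := by
  have hcl := g.toHomeomorph.image_closure (Metric.ball u r)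
  rw [IsometryEquiv.coe_toHomeomorph, g.image_ball] at hcl
  exact hcl ▸ h.image g.continuous

/-- The relation `pcRel` passes to pointwise limits of isometries. -/
theorem pcRel.of_tendsto {X : Type*} [MetricSpace X] {u v u' v' : X} {g : ℕ → X ≃ᵢ X}
    (h : pcRel u v) (hu : Tendsto (fun n => g n u) atTop (𝓝 u'))
    (hv : Tendsto (fun n => g n v) atTop (𝓝 v')) : pcRel u' v' := by
  obtain ⟨r, hr, hc⟩ := pcRel_iff.1 h
  have hd : dist u' v' = dist u v := by
    refine tendsto_nhds_unique (hu.dist hv) ?_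
    simp only [IsometryEquiv.dist_eq]
    exact tendsto_const_nhds
  obtain ⟨n, hn⟩ := (Metric.tendsto_nhds.1 hu ((r - dist u v) / 2) (by linarith)).exists
  refine pcRel_iff.2 ⟨(r + dist u v) / 2, by linarith, ?_⟩
  refine ((g n).isCompact_closure_ball hc).of_isClosed_subset isClosed_closure
    (closure_mono (Metric.ball_subset_ball' ?_))
  rw [dist_comm] at hn
  linarith

theorem pcRel.isCompact_closure_range {X : Type*} [MetricSpace X] {z w : X} {g : ℕ → X ≃ᵢ X}
    (h : pcRel z w) (hz : IsCompact (closure (range fun n => g n z))) :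
    IsCompact (closure (range fun n => g n w)) := by
  obtain ⟨r, hr, hc⟩ := pcRel_iff.1 h
  obtain ⟨t, ht, htf, hcov⟩ := Metric.finite_approx_of_totallyBounded
    (hz.totallyBounded.subset subset_closure) (r - dist z w) (by linarith)
  have hK : IsCompact (⋃ p ∈ t, closure (Metric.ball p r)) := by
    refine htf.isCompact_biUnion fun p hp => ?_
    obtain ⟨m, rfl⟩ := ht hp
    exact (g m).isCompact_closure_ball hc
  refine hK.closure_of_subset ?_
  rintro _ ⟨n, rfl⟩
  obtain ⟨p, hp, hn⟩ := mem_iUnion₂.1 (hcov (mem_range_self n))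
  refine mem_iUnion₂.2 ⟨p, hp, subset_closure ?_⟩
  rw [Metric.mem_ball] at hn ⊢
  have h1 := dist_triangle (g n w) (g n z) p
  rw [(g n).dist_eq, dist_comm w z] at h1
  linarith

theorem isCompact_closure_range_of_reflTransGen {X : Type*} [MetricSpace X] {x y z : X}
    {g : ℕ → X ≃ᵢ X} (hg : Tendsto (fun n => g n x) atTop (𝓝 y))
    (h : Relation.ReflTransGen pcRel x z) :
    IsCompact (closure (range fun n => g n z)) := by
  induction h with
  | refl => exact hg.isCompact_insert_range.closure_of_subset (subset_insert _ _)
  | tail _ hzw ih => exact hzw.isCompact_closure_range ih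

theorem exists_subseq_tendsto_of_isCompact_closure_range {X : Type*} [MetricSpace X]
    [SecondCountableTopology X] {S : Set X} (hne : S.Nonempty) {g : ℕ → X ≃ᵢ X}
    (hS : ∀ z ∈ S, IsCompact (closure (range fun n => g n z))) :
    ∃ φ : ℕ → ℕ, StrictMono φ ∧ ∃ F : X → X,
      ∀ z ∈ S, Tendsto (fun k => g (φ k) z) atTop (𝓝 (F z)) := by
  have : Nonempty S := hne.to_subtype
  let d : ℕ → S := TopologicalSpace.denseSeq S
  have hd : DenseRange d := TopologicalSpace.denseRange_denseSeq S
  obtain ⟨a, -, φ, hφ, hlim⟩ := (isCompact_univ_pi fun i => hS (d i) (d i).2).tendsto_subseq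
    (x := fun n i => g n (d i)) fun n i _ => subset_closure (mem_range_self n)
  rw [tendsto_pi_nhds] at hlim
  have key : ∀ z ∈ S, ∃ b, Tendsto (fun k => g (φ k) z) atTop (𝓝 b) := by
    intro z hz
    have hcau : CauchySeq fun k => g (φ k) z := by
      rw [Metric.cauchySeq_iff]
      intro ε hε
      obtain ⟨i, hi⟩ := hd.exists_dist_lt ⟨z, hz⟩ (ε := ε / 3) (by linarith)
      have hi : dist z (d i) < ε / 3 := hi
      obtain ⟨N, hN⟩ := Metric.cauchySeq_iff.1 (hlim i).cauchySeq (ε / 3) (by linarith)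
      refine ⟨N, fun m hm n hn => ?_⟩
      have h1 : dist (g (φ m) (d i)) (g (φ n) (d i)) < ε / 3 := hN m hm n hn
      have h2 := dist_triangle4 (g (φ m) z) (g (φ m) (d i)) (g (φ n) (d i)) (g (φ n) z)
      rw [(g (φ m)).dist_eq, (g (φ n)).dist_eq, dist_comm (d i : X) z] at h2
      linarith
    obtain ⟨b, -, hb⟩ := cauchySeq_tendsto_of_isComplete (hS z hz).isComplete
      (fun k => subset_closure (mem_range_self (φ k))) hcau
    exact ⟨b, hb⟩
  choose! F hF using key
  exact ⟨φ, hφ, F, hF⟩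

theorem pcEquiv.reflTransGen {X : Type*} [MetricSpace X] {x z : X} (h : pcEquiv x z) :
    Relation.ReflTransGen pcRel x z := by
  rcases h with rfl | h
  · exact .refl
  · exact h.1.to_reflTransGen

theorem transGen_pcRel_of_tendsto {X : Type*} [MetricSpace X] {x z w : X} {g : ℕ → X ≃ᵢ X}
    {F : X → X} (hF : ∀ z, Relation.ReflTransGen pcRel x z →
      Tendsto (fun n => g n z) atTop (𝓝 (F z)))
    (hz : Relation.ReflTransGen pcRel x z) (h : Relation.TransGen pcRel z w) :
    Relation.TransGen pcRel (F z) (F w) := by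
  induction h with
  | single h => exact .single (h.of_tendsto (hF _ hz) (hF _ (hz.tail h)))
  | tail hzb h ih =>
    have hb := hz.trans hzb.to_reflTransGen
    exact ih.tail (h.of_tendsto (hF _ hb) (hF _ (hb.tail h)))

theorem pcEquiv.of_tendsto {X : Type*} [MetricSpace X] {x z : X} {g : ℕ → X ≃ᵢ X}
    {F : X → X} (hF : ∀ z, Relation.ReflTransGen pcRel x z →
      Tendsto (fun n => g n z) atTop (𝓝 (F z))) (h : pcEquiv x z) :
    pcEquiv (F x) (F z) := by
  have hz := h.reflTransGen
  rcases h with rfl | ⟨h1, h2⟩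
  · exact Or.inl rfl
  · exact Or.inr ⟨transGen_pcRel_of_tendsto hF .refl h1, transGen_pcRel_of_tendsto hF hz h2⟩

theorem exists_subseq_tendsto_on_reflTransGen {X : Type*} [MetricSpace X]
    [SecondCountableTopology X] {x y : X} {g : ℕ → X ≃ᵢ X}
    (hg : Tendsto (fun n => g n x) atTop (𝓝 y)) :
    ∃ φ : ℕ → ℕ, StrictMono φ ∧ ∃ F : X → X, F x = y ∧
      ∀ z, Relation.ReflTransGen pcRel x z →
        Tendsto (fun k => g (φ k) z) atTop (𝓝 (F z)) := by
  obtain ⟨φ, hφ, F, hF⟩ := exists_subseq_tendsto_of_isCompact_closure_range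
    (S := {z | Relation.ReflTransGen pcRel x z}) ⟨x, .refl⟩
    fun z hz => isCompact_closure_range_of_reflTransGen hg hz
  exact ⟨φ, hφ, F, tendsto_nhds_unique (hF x .refl) (hg.comp hφ.tendsto_atTop), hF⟩

/-- In a second countable locally compact metric space, if `g_n·x → y` for a
sequence of isometries, then some subsequence converges pointwise on `C_x` to a
distance-preserving map `f` with `f(x) = y` and `f(C_x) = C_{f(x)}`. -/
theorem exists_subseq_pointwise_limit_on_pseudoComponent
    {X : Type*} [MetricSpace X] [LocallyCompactSpace X]
    [SecondCountableTopology X] (x y : X) (g : ℕ → X ≃ᵢ X)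
    (hg : Filter.Tendsto (fun n => g n x) Filter.atTop (nhds y)) :
    ∃ φ : ℕ → ℕ, StrictMono φ ∧
      ∃ f : pseudoComponent x → X,
        (∀ u v : pseudoComponent x, dist (f u) (f v) = dist (u : X) (v : X)) ∧
        (∀ z : pseudoComponent x,
          Filter.Tendsto (fun k => g (φ k) (z : X)) Filter.atTop (nhds (f z))) ∧
        f ⟨x, Or.inl rfl⟩ = y ∧
        Set.range f = pseudoComponent y := by
  obtain ⟨φ, hφ, F, rfl, hF⟩ := exists_subseq_tendsto_on_reflTransGen hg
  refine ⟨φ, hφ, fun z => F z, fun u v => ?_, fun z => hF z z.2.reflTransGen, rfl, ?_⟩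
  · refine tendsto_nhds_unique ((hF u u.2.reflTransGen).dist (hF v v.2.reflTransGen)) ?_
    simp only [IsometryEquiv.dist_eq]
    exact tendsto_const_nhds
  · refine Subset.antisymm (range_subset_iff.2 fun z => z.2.of_tendsto hF) fun w hw => ?_
    have hinv : Tendsto (fun k => (g (φ k)).symm (F x)) atTop (𝓝 x) := by
      rw [tendsto_iff_dist_tendsto_zero]
      refine (tendsto_iff_dist_tendsto_zero.1 (hF x .refl)).congr fun k => ?_
      rw [← (g (φ k)).dist_eq ((g (φ k)).symm (F x)), IsometryEquiv.apply_symm_apply, dist_comm]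
    obtain ⟨ψ, hψ, H, hH, hHlim⟩ := exists_subseq_tendsto_on_reflTransGen hinv
    have hmem : pcEquiv x (H w) := hH ▸ pcEquiv.of_tendsto hHlim hw
    refine ⟨⟨H w, hmem⟩, tendsto_nhds_unique
      ((hF _ hmem.reflTransGen).comp hψ.tendsto_atTop) ?_⟩
    rw [tendsto_iff_dist_tendsto_zero]
    refine (tendsto_iff_dist_tendsto_zero.1 (hHlim w hw.reflTransGen)).congr fun k => ?_
    rw [← (g (φ (ψ k))).dist_eq, IsometryEquiv.apply_symm_apply, dist_comm, Function.comp_apply]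
end

section
/- Let (X,d) be a locally compact metric space, G its group of surjective isometries, F ⊆ G, and x ∈ X. If the set F·x = {g·x : g ∈ F} has compact closure in X, then for every z in the pseudo-component C_x of x the set F·z = {g·z : g ∈ F} has compact closure in X. -/
open Metric Set Filter Topology
open scoped ENNReal

lemma exists_isCompact_closure_ball_of_pcRel {X : Type*} [MetricSpace X] {x y : X}
    (h : pcRel x y) : ∃ r : ℝ, dist x y < r ∧ IsCompact (closure (Metric.ball x r)) := by
  obtain ⟨r, hr⟩ := lt_iSup_iff.mp h
  obtain ⟨⟨_, hc⟩, hr⟩ := lt_iSup_iff.mp hr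
  exact ⟨r, (ENNReal.ofReal_lt_ofReal_iff'.mp hr).1, hc⟩

lemma isCompact_closure_ball_apply {X : Type*} [MetricSpace X] (g : X ≃ᵢ X) {x : X} {r : ℝ}
    (h : IsCompact (closure (Metric.ball x r))) : IsCompact (closure (Metric.ball (g x) r)) := by
  rw [← g.image_ball, ← g.coe_toHomeomorph, ← g.toHomeomorph.image_closure]
  exact h.image g.toHomeomorph.continuous

/-- Compactness of the closure of an orbit propagates along the relation `pcRel`. -/
lemma isCompact_closure_orbit_of_pcRel {X : Type*} [MetricSpace X] (F : Set (X ≃ᵢ X)) {y z : X}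
    (hF : IsCompact (closure ((fun g : X ≃ᵢ X => g y) '' F))) (h : pcRel y z) :
    IsCompact (closure ((fun g : X ≃ᵢ X => g z) '' F)) := by
  obtain ⟨r, hr, hc⟩ := exists_isCompact_closure_ball_of_pcRel h
  obtain ⟨t, htF, ht, hcover⟩ := Metric.finite_approx_of_totallyBounded
    (hF.totallyBounded.subset subset_closure) (r - dist y z) (sub_pos.mpr hr)
  have hK : IsCompact (⋃ p ∈ t, closure (Metric.ball p r)) := by
    refine ht.isCompact_biUnion fun p hp => ?_
    obtain ⟨g, -, rfl⟩ := htF hp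
    exact isCompact_closure_ball_apply g hc
  refine hK.closure_of_subset ?_
  rintro _ ⟨g, hg, rfl⟩
  obtain ⟨p, hp, hgp⟩ := mem_iUnion₂.mp (hcover (mem_image_of_mem _ hg))
  refine mem_iUnion₂.mpr ⟨p, hp, subset_closure ?_⟩
  rw [Metric.mem_ball] at hgp ⊢
  have h₁ := dist_triangle (g z) (g y) p
  rw [g.dist_eq, dist_comm z y] at h₁
  linarith

/-- If `F` is a set of isometries of a locally compact metric space and
`F·x` has compact closure, then `F·z` has compact closure for every `z` in the
pseudo-component of `x`. -/
theorem orbit_compact_closure_on_pseudoComponent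
    {X : Type*} [MetricSpace X] [LocallyCompactSpace X]
    (F : Set (X ≃ᵢ X)) (x : X)
    (hF : IsCompact (closure ((fun g : X ≃ᵢ X => g x) '' F))) :
    ∀ z ∈ pseudoComponent x,
      IsCompact (closure ((fun g : X ≃ᵢ X => g z) '' F)) := by
  rintro z (rfl | ⟨hxz, -⟩)
  · exact hF
  · induction hxz with
    | single h => exact isCompact_closure_orbit_of_pcRel F hF h
    | tail _ h ih => exact isCompact_closure_orbit_of_pcRel F ih h
end

section
/- Let X = P ∪ S ⊆ ℝ³, where P = {(x,y,0) : x,y ∈ ℝ} and S = {(x,y,2) : x² + y² = 1}, equipped with the metric d = min{d_E, 1}, where d_E is the Euclidean metric of ℝ³. Then X is a locally compact metric space, and for any point s ∈ S the isotropy group {g ∈ G : g(s) = s} of the group G of surjective isometries of (X,d) (with the topology of pointwise convergence) is not compact; in particular the action of G on the compact set S is not proper. -/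
open Metric Set

/-- The plane `P = {(x,y,0)}` in `ℝ³`. -/
def planeSet : Set (EuclideanSpace ℝ (Fin 3)) := {p | p 2 = 0}

/-- The circle `S = {(x,y,2) : x² + y² = 1}` in `ℝ³`. -/
def circleSet : Set (EuclideanSpace ℝ (Fin 3)) :=
  {p | p 2 = 2 ∧ (p 0) ^ 2 + (p 1) ^ 2 = 1}

/-- The space `X = P ∪ S ⊆ ℝ³`. -/
def ExSpace : Type := ↥(planeSet ∪ circleSet)

/-- `X` is equipped with the truncated metric `d = min(d_E, 1)`, where `d_E` is the
Euclidean metric of `ℝ³`. -/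
noncomputable instance : MetricSpace ExSpace where
  dist p q := min (dist p.1 q.1) 1
  dist_self p := by simp
  dist_comm p q := by simp [dist_comm]
  dist_triangle p q r := by
    rcases le_total 1 (dist p.1 q.1) with h | h
    · calc min (dist p.1 r.1) 1 ≤ 1 := min_le_right _ _
        _ ≤ min (dist p.1 q.1) 1 + min (dist q.1 r.1) 1 :=
          le_add_of_nonneg_right (le_min dist_nonneg zero_le_one) |>.trans_eq' (by
            rw [min_eq_right h])
    · rcases le_total 1 (dist q.1 r.1) with h' | h'
      · calc min (dist p.1 r.1) 1 ≤ 1 := min_le_right _ _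
          _ = min (dist q.1 r.1) 1 := (min_eq_right h').symm
          _ ≤ min (dist p.1 q.1) 1 + min (dist q.1 r.1) 1 :=
            le_add_of_nonneg_left (le_min dist_nonneg zero_le_one)
      · calc min (dist p.1 r.1) 1 ≤ dist p.1 r.1 := min_le_left _ _
          _ ≤ dist p.1 q.1 + dist q.1 r.1 := dist_triangle _ _ _
          _ = min (dist p.1 q.1) 1 + min (dist q.1 r.1) 1 := by
            rw [min_eq_left h, min_eq_left h']
  eq_of_dist_eq_zero {p q} h := by
    have h1 : dist p.1 q.1 = 0 ∨ (1 : ℝ) = 0 := min_eq_iff.mp (by simpa using h) |>.imp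
      (fun h => h.1) (fun h => h.1)
    rcases h1 with h1 | h1
    · exact Subtype.ext (dist_eq_zero.mp h1)
    · norm_num at h1

/-- The topology of pointwise convergence on the group of surjective isometries. -/
noncomputable instance isomGroupTopology (X : Type*) [MetricSpace X] :
    TopologicalSpace (X ≃ᵢ X) :=
  TopologicalSpace.induced (fun g => (g : X → X)) Pi.topologicalSpace

theorem ExSpace.dist_def (p q : ExSpace) : dist p q = min (dist p.1 q.1) 1 := rfl

/-- The inclusion of `X` into `ℝ³`. -/
def ExSpace.incl (p : ExSpace) : EuclideanSpace ℝ (Fin 3) := p.1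

theorem isClosed_planeSet : IsClosed planeSet :=
  isClosed_eq (by fun_prop) continuous_const

theorem isClosed_circleSet : IsClosed circleSet :=
  (isClosed_eq (by fun_prop) continuous_const).inter
    (isClosed_eq (by fun_prop) continuous_const)

theorem isCompact_circleSet : IsCompact circleSet := by
  refine Metric.isCompact_of_isClosed_isBounded isClosed_circleSet ?_
  refine (isBounded_iff_forall_norm_le).2 ⟨3, fun p hp => ?_⟩
  obtain ⟨h2, h1⟩ := hp
  rw [EuclideanSpace.norm_eq, Real.sqrt_le_left (by norm_num)]
  simp only [Real.norm_eq_abs, sq_abs, Fin.sum_univ_three]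
  rw [h1, h2]
  norm_num

theorem ExSpace.isUniformInducing_incl : IsUniformInducing ExSpace.incl := by
  refine Metric.isUniformInducing_iff.2 ⟨?_, fun δ hδ => ?_⟩
  · refine Metric.uniformContinuous_iff.2 fun ε hε => ⟨min ε 1, by positivity, ?_⟩
    intro p q h
    rw [ExSpace.dist_def] at h
    have h1 : dist p.1 q.1 < 1 := by
      by_contra! hc
      rw [min_eq_right hc] at h
      exact absurd h (not_lt.2 (min_le_right _ _))
    rw [min_eq_left h1.le] at h
    exact h.trans_le (min_le_left _ _)
  · exact ⟨δ, hδ, fun {p q} h => (min_le_left _ _).trans_lt h⟩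

theorem ExSpace.isClosedEmbedding_incl : Topology.IsClosedEmbedding ExSpace.incl where
  toIsInducing := ExSpace.isUniformInducing_incl.isInducing
  injective := Subtype.val_injective
  isClosed_range := by
    have : range ExSpace.incl = planeSet ∪ circleSet := Subtype.range_coe
    rw [this]
    exact isClosed_planeSet.union isClosed_circleSet

/-- Translation of the plane by `t` along the first axis, fixing the circle pointwise. -/
noncomputable def ExSpace.shift (t : ℝ) (p : ExSpace) : ExSpace :=
  open Classical in
  if h : p.1 ∈ planeSet then
    ⟨p.1 + EuclideanSpace.single 0 t, Or.inl (by
      have h' : p.1 2 = 0 := h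
      simp [planeSet, h'])⟩
  else p

theorem ExSpace.shift_plane (t : ℝ) {p : ExSpace} (h : p.1 ∈ planeSet) :
    (ExSpace.shift t p).1 = p.1 + EuclideanSpace.single 0 t := by
  simp [ExSpace.shift, h]

theorem ExSpace.shift_of_notMem (t : ℝ) {p : ExSpace} (h : p.1 ∉ planeSet) :
    ExSpace.shift t p = p := by
  simp [ExSpace.shift, h]

theorem ExSpace.shift_mem_planeSet (t : ℝ) {p : ExSpace} (h : p.1 ∈ planeSet) :
    (ExSpace.shift t p).1 ∈ planeSet := by
  have h' : p.1 2 = 0 := h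
  rw [ExSpace.shift_plane t h]
  simp [planeSet, h']

theorem notMem_planeSet_of_mem_circleSet {p : EuclideanSpace ℝ (Fin 3)}
    (h : p ∈ circleSet) : p ∉ planeSet := by
  intro h'
  have h0 : p 2 = 0 := h'
  have h2 : p 2 = 2 := h.1
  linarith

theorem ExSpace.dist_eq_one {p q : ExSpace} (hp : p.1 ∈ planeSet) (hq : q.1 ∉ planeSet) :
    dist p q = 1 := by
  have hp' : p.1 2 = 0 := hp
  have hq' : q.1 2 = 2 := (q.2.resolve_left hq).1
  rw [ExSpace.dist_def]
  refine min_eq_right ?_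
  have h := PiLp.norm_apply_le (p.1 - q.1) 2
  rw [PiLp.sub_apply, hp', hq'] at h
  norm_num at h
  rw [dist_eq_norm]
  linarith

theorem ExSpace.isometry_shift (t : ℝ) : Isometry (ExSpace.shift t) := by
  refine Isometry.of_dist_eq fun p q => ?_
  by_cases hp : p.1 ∈ planeSet <;> by_cases hq : q.1 ∈ planeSet
  · rw [ExSpace.dist_def, ExSpace.dist_def, ExSpace.shift_plane t hp, ExSpace.shift_plane t hq,
      dist_add_right]
  · rw [ExSpace.shift_of_notMem t hq, ExSpace.dist_eq_one hp hq,
      ExSpace.dist_eq_one (ExSpace.shift_mem_planeSet t hp) hq]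
  · rw [ExSpace.shift_of_notMem t hp, dist_comm, dist_comm p, ExSpace.dist_eq_one hq hp,
      ExSpace.dist_eq_one (ExSpace.shift_mem_planeSet t hq) hp]
  · rw [ExSpace.shift_of_notMem t hp, ExSpace.shift_of_notMem t hq]

theorem ExSpace.shift_shift_neg (t : ℝ) (p : ExSpace) :
    ExSpace.shift t (ExSpace.shift (-t) p) = p := by
  by_cases hp : p.1 ∈ planeSet
  · apply Subtype.ext
    rw [ExSpace.shift_plane t (ExSpace.shift_mem_planeSet _ hp), ExSpace.shift_plane _ hp]
    ext i
    fin_cases i <;> simp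
  · rw [ExSpace.shift_of_notMem _ hp, ExSpace.shift_of_notMem _ hp]

/-- `ExSpace.shift` as a surjective isometry. -/
noncomputable def ExSpace.shiftEquiv (t : ℝ) : ExSpace ≃ᵢ ExSpace :=
  IsometryEquiv.mk' (ExSpace.shift t) (ExSpace.shift (-t)) (ExSpace.shift_shift_neg t)
    (ExSpace.isometry_shift t)

theorem ExSpace.not_isCompact_isotropy {s : ExSpace} (hs : s.1 ∈ circleSet) :
    ¬ IsCompact {g : ExSpace ≃ᵢ ExSpace | g s = s} := by
  intro hc
  have h0 : (0 : EuclideanSpace ℝ (Fin 3)) ∈ planeSet := by simp [planeSet]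
  let o : ExSpace := ⟨0, Or.inl h0⟩
  have heval : Continuous fun g : ExSpace ≃ᵢ ExSpace => ExSpace.incl (g o) :=
    ExSpace.isClosedEmbedding_incl.continuous.comp
      ((continuous_apply o).comp continuous_induced_dom)
  obtain ⟨C, hC⟩ := isBounded_iff_forall_norm_le.1 (hc.image heval).isBounded
  have hfix : ExSpace.shiftEquiv (|C| + 1) s = s :=
    ExSpace.shift_of_notMem _ (notMem_planeSet_of_mem_circleSet hs)
  have hval : ExSpace.incl (ExSpace.shiftEquiv (|C| + 1) o) =
      EuclideanSpace.single 0 (|C| + 1) :=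
    (ExSpace.shift_plane _ h0).trans (zero_add _)
  have h := hC _ ⟨ExSpace.shiftEquiv (|C| + 1), hfix, rfl⟩
  simp only [hval, PiLp.norm_single, Real.norm_eq_abs] at h
  linarith [le_abs_self C, le_abs_self (|C| + 1)]

/-- `X = P ∪ S` with the truncated Euclidean metric is a locally compact
metric space, `S` is compact, the isotropy group of any point of `S` in the isometry
group `G` is not compact, and the evaluation action of `G` on `S` is not proper. -/
theorem example_isotropy_not_compact :
    LocallyCompactSpace ExSpace ∧
    IsCompact {p : ExSpace | p.1 ∈ circleSet} ∧
    (∀ s : ExSpace, s.1 ∈ circleSet →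
      ¬ IsCompact {g : ExSpace ≃ᵢ ExSpace | g s = s}) ∧
    ¬ IsProperMap (fun q : (ExSpace ≃ᵢ ExSpace) × {p : ExSpace | p.1 ∈ circleSet} =>
        ((q.1 q.2.1, q.2.1) : ExSpace × ExSpace)) := by
  have hcircle : IsCompact {p : ExSpace | p.1 ∈ circleSet} :=
    ExSpace.isClosedEmbedding_incl.isCompact_preimage isCompact_circleSet
  refine ⟨ExSpace.isClosedEmbedding_incl.locallyCompactSpace, hcircle,
    fun s hs => ExSpace.not_isCompact_isotropy hs, fun hproper => ?_⟩
  let s : ExSpace := ⟨!₂[1, 0, 2], Or.inr (by simp [circleSet])⟩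
  have hs : s.1 ∈ circleSet := by simp [s, circleSet]
  refine ExSpace.not_isCompact_isotropy hs ?_
  convert (hproper.isCompact_preimage (isCompact_singleton (x := (s, s)))).image
    continuous_fst using 1
  ext g
  constructor
  · intro hg
    exact ⟨(g, ⟨s, hs⟩), Prod.ext hg rfl, rfl⟩
  · rintro ⟨⟨g', p⟩, h, rfl⟩
    obtain ⟨h1, h2⟩ := Prod.ext_iff.1 h
    simp only at h1 h2
    rw [h2] at h1
    exact h1
end
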